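/- The Thue–Morse language L_{M^∞} is not balanced for length 2: for each n ≥ 1 there exist words w, w' ∈ L_{M^∞} with |w| = |w'| and |w|_{11} − |w'|_{11} = n. In particular, the differences ||w|_v − |w'|_v| over pairs w, w' ∈ L_{M^∞} of equal length are unbounded for v = 11 (and likewise for v ∈ {00, 01, 10}). -/

import Mathlib

open List

/-- Number of occurrences of `v` as a factor of `w`, i.e. the number of
decompositions `w = p ++ v ++ s`. -/
def occ {A : Type*} [DecidableEq A] (v w : List A) : ℕ :=
  (List.range (w.length + 1)).countP (fun i => decide (v <+: w.drop i))

/-- Apply a substitution (given by its values on letters) to a word. -/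
def applyS {A B : Type*} (σ : A → List B) (w : List A) : List B :=
  (w.map σ).flatten

/-- The substitution `L : 0 ↦ 0, 1 ↦ 10` (with `0 = false`, `1 = true`). -/
def Lsub : Bool → List Bool
  | false => [false]
  | true => [true, false]

/-- The (Thue–Morse) substitution `M : 0 ↦ 01, 1 ↦ 10`. -/
def Msub : Bool → List Bool
  | false => [false, true]
  | true => [true, false]

/-- The substitution `R : 0 ↦ 01, 1 ↦ 1`. -/
def Rsub : Bool → List Bool
  | false => [false, true]
  | true => [true]

/-- The iterate `σ^n` of a substitution, on letters. -/
def iter {A : Type*} (σ : A → List A) : ℕ → A → List A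
  | 0, a => [a]
  | n + 1, a => applyS σ (iter σ n a)

/-- The Thue–Morse language: words that are factors of `M^n(a)` for some letter `a`,
for infinitely many `n`. -/
def LangTM : Set (List Bool) :=
  {w | {n : ℕ | ∃ a : Bool, w <:+: iter Msub n a}.Infinite}

lemma occ_nil_of_ne_nil {A : Type*} [DecidableEq A] {v : List A} (hv : v ≠ []) :
    occ v [] = 0 := by
  simp [occ, hv]

lemma occ_cons {A : Type*} [DecidableEq A] (v : List A) (x : A) (w : List A) :
    occ v (x :: w) = (if v <+: x :: w then 1 else 0) + occ v w := by
  unfold occ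
  rw [List.length_cons, List.range_succ_eq_map, List.countP_cons, List.countP_map, add_comm]
  congr 1
  simp

lemma occ_pair_cons_cons (a b x y : Bool) (w : List Bool) :
    occ [a, b] (x :: y :: w) = (if a = x ∧ b = y then 1 else 0) + occ [a, b] (y :: w) := by
  rw [occ_cons]
  simp [List.cons_prefix_cons]

lemma occ_pair_nil (a b : Bool) : occ [a, b] [] = 0 := occ_nil_of_ne_nil (by simp)

lemma occ_pair_singleton (a b x : Bool) : occ [a, b] [x] = 0 := by
  rw [occ_cons, occ_pair_nil]
  simp [List.cons_prefix_cons]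

lemma occ_true_true_append_false (u s : List Bool) :
    occ [true, true] (u ++ false :: s) =
      occ [true, true] u + occ [true, true] (false :: s) := by
  induction u with
  | nil => simp [occ_pair_nil]
  | cons x u ih =>
    cases u with
    | nil => simp [occ_pair_singleton, occ_pair_cons_cons]
    | cons y u =>
      simp only [List.cons_append, occ_pair_cons_cons] at ih ⊢
      omega

lemma applyS_nil {A B : Type*} (σ : A → List B) : applyS σ [] = [] := rfl

lemma applyS_cons {A B : Type*} (σ : A → List B) (x : A) (w : List A) :
    applyS σ (x :: w) = σ x ++ applyS σ w := rfl

lemma applyS_append {A B : Type*} (σ : A → List B) (u w : List A) :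
    applyS σ (u ++ w) = applyS σ u ++ applyS σ w := by
  simp [applyS]

lemma applyS_isInfix {A B : Type*} (σ : A → List B) {u w : List A} (h : u <:+: w) :
    applyS σ u <:+: applyS σ w := by
  obtain ⟨p, s, rfl⟩ := h
  exact ⟨applyS σ p, applyS σ s, by simp [applyS_append]⟩

lemma length_applyS_Msub (w : List Bool) : (applyS Msub w).length = 2 * w.length := by
  induction w with
  | nil => rfl
  | cons x w ih => cases x <;> simp [applyS_cons, Msub, ih] <;> omega

lemma count_false_applyS_Msub (w : List Bool) : (applyS Msub w).count false = w.length := by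
  induction w with
  | nil => rfl
  | cons x w ih => cases x <;> simp [applyS_cons, Msub, ih]

lemma occ_true_true_applyS_Msub (w : List Bool) :
    occ [true, true] (applyS Msub w) = occ [false, true] w := by
  induction w with
  | nil => simp [applyS_nil, occ_pair_nil]
  | cons x w ih =>
    cases w with
    | nil => cases x <;> simp [applyS, Msub, occ_pair_singleton, occ_pair_cons_cons]
    | cons y w =>
      cases x <;> cases y <;>
        simp [applyS_cons, Msub, occ_pair_cons_cons] at ih ⊢ <;> omega

lemma occ_false_true_applyS_Msub (w : List Bool) :
    occ [false, true] (applyS Msub w) = w.count false + occ [true, true] w := by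
  induction w with
  | nil => simp [applyS_nil, occ_pair_nil]
  | cons x w ih =>
    cases w with
    | nil => cases x <;> simp [applyS, Msub, occ_pair_singleton, occ_pair_cons_cons]
    | cons y w =>
      cases x <;> cases y <;>
        simp [applyS_cons, Msub, occ_pair_cons_cons] at ih ⊢ <;> omega

/-- The fourth power of the Thue–Morse substitution, on words. -/
def morseFour (w : List Bool) : List Bool :=
  applyS Msub (applyS Msub (applyS Msub (applyS Msub w)))

lemma morseFour_append (u w : List Bool) : morseFour (u ++ w) = morseFour u ++ morseFour w := by
  simp [morseFour, applyS_append]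

lemma morseFour_false : morseFour [false] =
    [false, true, true, false, true, false, false, true,
      true, false, false, true, false, true, true, false] := rfl

lemma length_morseFour (w : List Bool) : (morseFour w).length = 16 * w.length := by
  simp only [morseFour, length_applyS_Msub]; omega

lemma count_false_morseFour (w : List Bool) : (morseFour w).count false = 8 * w.length := by
  simp only [morseFour, length_applyS_Msub, count_false_applyS_Msub]; omega

lemma occ_true_true_morseFour (w : List Bool) : occ [true, true] (morseFour w) =
    2 * w.length + w.count false + occ [true, true] w := by
  simp only [morseFour, length_applyS_Msub, count_false_applyS_Msub, occ_true_true_applyS_Msub,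
    occ_false_true_applyS_Msub]
  omega

lemma mem_LangTM_of_isInfix {u w : List Bool} (hw : w ∈ LangTM) (h : u <:+: w) : u ∈ LangTM :=
  Set.Infinite.mono (s := {n : ℕ | ∃ a : Bool, w <:+: _root_.iter Msub n a})
    (fun _ ⟨a, ha⟩ => ⟨a, h.trans ha⟩) hw

lemma applyS_Msub_mem_LangTM {w : List Bool} (hw : w ∈ LangTM) : applyS Msub w ∈ LangTM := by
  refine (Set.Infinite.image (f := Nat.succ) Nat.succ_injective.injOn hw).mono ?_
  rintro _ ⟨n, ⟨a, ha⟩, rfl⟩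
  exact ⟨a, applyS_isInfix Msub ha⟩

lemma morseFour_mem_LangTM {w : List Bool} (hw : w ∈ LangTM) : morseFour w ∈ LangTM :=
  applyS_Msub_mem_LangTM <| applyS_Msub_mem_LangTM <| applyS_Msub_mem_LangTM <|
    applyS_Msub_mem_LangTM hw

lemma false_mem_LangTM : [false] ∈ LangTM := by
  have h (n : ℕ) : [false] <+: iter Msub n false := by
    induction n with
    | zero => exact List.prefix_rfl
    | succ n ih =>
      obtain ⟨s, hs⟩ := ih
      exact ⟨true :: applyS Msub s, by rw [_root_.iter, ← hs]; rfl⟩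
  exact Set.infinite_univ.mono fun n _ => ⟨false, (h n).isInfix⟩

lemma applyS_Msub_map_not (w : List Bool) :
    applyS Msub (w.map not) = (applyS Msub w).map not := by
  induction w with
  | nil => rfl
  | cons x w ih => cases x <;> simp [applyS_cons, Msub, ih]

lemma iter_Msub_not (n : ℕ) (a : Bool) : iter Msub n (!a) = (iter Msub n a).map not := by
  induction n with
  | zero => rfl
  | succ n ih => rw [_root_.iter, _root_.iter, ih, applyS_Msub_map_not]

lemma map_not_mem_LangTM {w : List Bool} (hw : w ∈ LangTM) : w.map not ∈ LangTM := by
  refine Set.Infinite.mono ?_ hw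
  rintro n ⟨a, ha⟩
  exact ⟨!a, by rw [iter_Msub_not]; exact ha.map not⟩

lemma occ_pair_map_not (a b : Bool) (w : List Bool) :
    occ [!a, !b] (w.map not) = occ [a, b] w := by
  induction w with
  | nil => simp [occ_pair_nil]
  | cons x w ih =>
    cases w with
    | nil => simp [occ_pair_singleton]
    | cons y w =>
      simp only [List.map_cons, occ_pair_cons_cons] at ih ⊢
      simp [ih]

/-- Equal-length Thue–Morse words whose numbers of factors `11` differ by `k` and whose numbers
of letters `0` differ by one; both can be extended to the right by the letter `0`. -/
lemma exists_LangTM_pair (k : ℕ) : ∃ p r : List Bool,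
    p ++ [false] ∈ LangTM ∧ (false :: r) ++ [false] ∈ LangTM ∧
    (false :: r).length = p.length ∧
    (false :: r).count false = p.count false + 1 ∧
    occ [true, true] (false :: r) = occ [true, true] p + k := by
  induction k with
  | zero =>
    have h := morseFour_mem_LangTM false_mem_LangTM
    refine ⟨[false, true, true, false, true], [false, true, true, false],
      mem_LangTM_of_isInfix h ?_, mem_LangTM_of_isInfix h ?_, ?_, ?_, ?_⟩ <;> decide
  | succ k ih =>
    obtain ⟨p, r, hp, hr, hlen, hcount, hocc⟩ := ih
    have hsplit : morseFour (false :: r) = [false, true, true, false, true] ++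
        false :: ([false, true, true, false, false, true, false, true, true, false] ++
          morseFour r) := by
      rw [← List.singleton_append, morseFour_append, morseFour_false]; rfl
    have hlen' := length_morseFour (false :: r)
    have hcount' := count_false_morseFour (false :: r)
    have hocc' := occ_true_true_morseFour (false :: r)
    rw [hsplit] at hlen' hcount' hocc'
    rw [occ_true_true_append_false] at hocc'
    have hs : occ [true, true] [false, true, true, false, true] = 1 := by decide
    have hx : occ [true, true]
        [false, true, true, false, true, false, false, true, true, false] = 2 := by decide
    refine ⟨morseFour p ++ [false, true, true, false, true],
      ([false, true, true, false, false, true, false, true, true, false] ++ morseFour r) ++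
        [false, true, true, false, true, false, false, true, true, false], ?_, ?_, ?_, ?_, ?_⟩
    · refine mem_LangTM_of_isInfix (morseFour_mem_LangTM hp) ⟨[],
        [false, true, true, false, false, true, false, true, true, false], ?_⟩
      simp [morseFour_append, morseFour_false]
    · refine mem_LangTM_of_isInfix (morseFour_mem_LangTM hr)
        ⟨[false, true, true, false, true], [true, false, true, true, false], ?_⟩
      rw [morseFour_append, hsplit, morseFour_false]
      simp
    · simp [length_morseFour] at hlen hlen' ⊢
      omega
    · simp [count_false_morseFour] at hlen hcount hcount' ⊢
      omega
    · rw [← List.cons_append, occ_true_true_append_false, occ_true_true_append_false,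
        occ_true_true_morseFour]
      omega

/-- the Thue–Morse language is not balanced for length `2`: for each
`n ≥ 1` there are equal-length words `w, w'` in it with `|w|_{11} - |w'|_{11} = n`;
in particular, for every word `v` of length `2` the differences `||w|_v - |w'|_v|`
over pairs of equal-length words are unbounded. -/
theorem thueMorse_not_balanced_length_two :
    (∀ n : ℕ, 1 ≤ n → ∃ w ∈ LangTM, ∃ w' ∈ LangTM, w.length = w'.length ∧
      (occ [true, true] w : ℤ) - (occ [true, true] w' : ℤ) = (n : ℤ)) ∧
    (∀ v : List Bool, v.length = 2 → ¬ ∃ C : ℕ, ∀ w ∈ LangTM, ∀ w' ∈ LangTM,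
      w.length = w'.length → |(occ v w : ℤ) - (occ v w' : ℤ)| ≤ (C : ℤ)) := by
  refine ⟨fun n _ => ?_, fun v hv => ?_⟩
  · obtain ⟨p, r, hp, hr, hlen, -, hocc⟩ := exists_LangTM_pair n
    refine ⟨_, mem_LangTM_of_isInfix hr (List.prefix_append _ _).isInfix,
      _, mem_LangTM_of_isInfix hp (List.prefix_append _ _).isInfix, hlen, ?_⟩
    rw [hocc]
    push_cast
    ring
  · rintro ⟨C, hC⟩
    obtain ⟨p, r, hp, hr, hlen, hcount, hocc⟩ := exists_LangTM_pair (C + 1)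
    replace hp := mem_LangTM_of_isInfix hp (List.prefix_append _ _).isInfix
    replace hr := mem_LangTM_of_isInfix hr (List.prefix_append _ _).isInfix
    generalize false :: r = q at *
    have hMp := applyS_Msub_mem_LangTM hp
    have hMq := applyS_Msub_mem_LangTM hr
    have hMlen : (applyS Msub q).length = (applyS Msub p).length := by
      rw [length_applyS_Msub, length_applyS_Msub, hlen]
    have hMocc : occ [false, true] (applyS Msub q) = occ [false, true] (applyS Msub p) + C + 2 := by
      rw [occ_false_true_applyS_Msub, occ_false_true_applyS_Msub]
      omega
    obtain ⟨a, b, rfl⟩ := List.length_eq_two.mp hv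
    have key {u w : List Bool} (hu : u ∈ LangTM) (hw : w ∈ LangTM) (h : u.length = w.length) :
        occ [a, b] u ≤ occ [a, b] w + C := by
      have := (abs_le.mp (hC u hu w hw h)).2
      omega
    cases a <;> cases b
    · have := key (map_not_mem_LangTM hr) (map_not_mem_LangTM hp) (by simpa using hlen)
      have hq := occ_pair_map_not true true q
      have hp := occ_pair_map_not true true p
      simp only [Bool.not_true] at hq hp
      omega
    · have := key hMq hMp hMlen
      omega
    · have := key (map_not_mem_LangTM hMq) (map_not_mem_LangTM hMp) (by simpa using hMlen)
      have hq := occ_pair_map_not false true (applyS Msub q)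
      have hp := occ_pair_map_not false true (applyS Msub p)
      simp only [Bool.not_true, Bool.not_false] at hq hp
      omega
    · have := key hr hp hlen
      omega
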